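/- Let G be a connected graph of order n ≥ 3 that is not isomorphic to the complete graph K_n. Then the negative 4-energy of G satisfies E_4^-(G) ≥ n. -/

import Mathlib

open Matrix Finset
open scoped Classical

lemma adjMatrix_isHermitian {V : Type*} [Fintype V] [DecidableEq V] (G : SimpleGraph V) :
    (G.adjMatrix ℝ).IsHermitian :=
  Matrix.IsHermitian.ext fun i j => by simp [SimpleGraph.adj_comm]

/-- The positive `p`-energy of a graph: the sum of the `p`-th powers of the positive
eigenvalues of its adjacency matrix (counted with multiplicity). -/
noncomputable def gPosEnergy {V : Type*} [Fintype V] [DecidableEq V]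
    (G : SimpleGraph V) (p : ℝ) : ℝ :=
  ∑ i, if 0 < (adjMatrix_isHermitian G).eigenvalues i then
    (adjMatrix_isHermitian G).eigenvalues i ^ p else 0

/-- The negative `p`-energy of a graph: the sum of the `p`-th powers of the absolute values
of the negative eigenvalues of its adjacency matrix (counted with multiplicity). -/
noncomputable def gNegEnergy {V : Type*} [Fintype V] [DecidableEq V]
    (G : SimpleGraph V) (p : ℝ) : ℝ :=
  ∑ i, if (adjMatrix_isHermitian G).eigenvalues i < 0 then
    |(adjMatrix_isHermitian G).eigenvalues i| ^ p else 0

namespace NegEnergy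

variable {V : Type*} [Fintype V] (G : SimpleGraph V)

/-- The quadratic form of the adjacency matrix. -/
noncomputable def adjForm (u : V → ℝ) : ℝ := ∑ x, ∑ y, if G.Adj x y then u x * u y else 0

/-- `S` carries pairwise orthogonal nonzero vectors whose Rayleigh quotients are at most `-c i`,
with `c i ≥ 0` and `∑ c i ^ 4 ≥ w`. -/
def Certified (S : Finset V) (w : ℝ) : Prop :=
  ∃ (m : ℕ) (u : Fin m → V → ℝ) (c : Fin m → ℝ),
    (∀ i, u i ≠ 0) ∧ (∀ i, ∀ v ∉ S, u i v = 0) ∧ (∀ i j, i ≠ j → ∑ v, u i v * u j v = 0) ∧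
    (∀ i, 0 ≤ c i) ∧ (∀ i, adjForm G (u i) ≤ -c i * ∑ v, u i v * u i v) ∧ w ≤ ∑ i, c i ^ 4

variable {G}

lemma Certified.mono {S : Finset V} {w w' : ℝ} (h : Certified G S w) (hw : w' ≤ w) :
    Certified G S w' := by
  obtain ⟨m, u, c, h1, h2, h3, h4, h5, h6⟩ := h
  exact ⟨m, u, c, h1, h2, h3, h4, h5, hw.trans h6⟩

lemma sum_eq_sum_of_support {S : Finset V} {u : V → ℝ} (hu : ∀ v ∉ S, u v = 0) (g : V → ℝ) :
    ∑ v, u v * g v = ∑ v ∈ S, u v * g v :=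
  (Finset.sum_subset (Finset.subset_univ S) fun v _ hv => by rw [hu v hv, zero_mul]).symm

lemma adjForm_eq_sum {S : Finset V} {u : V → ℝ} (hu : ∀ v ∉ S, u v = 0) :
    adjForm G u = ∑ x ∈ S, ∑ y ∈ S, if G.Adj x y then u x * u y else 0 := by
  unfold adjForm
  rw [← Finset.sum_subset (Finset.subset_univ S) (fun v _ hv => by simp [hu v hv])]
  refine Finset.sum_congr rfl fun x _ => ?_
  rw [← Finset.sum_subset (Finset.subset_univ S) (fun v _ hv => by simp [hu v hv])]

variable [DecidableEq V]

lemma Certified.union {S T : Finset V} {w w' : ℝ} (hS : Certified G S w) (hT : Certified G T w')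
    (hST : Disjoint S T) : Certified G (S ∪ T) (w + w') := by
  obtain ⟨m, u, c, h1, h2, h3, h4, h5, h6⟩ := hS
  obtain ⟨m', u', c', h1', h2', h3', h4', h5', h6'⟩ := hT
  have key : ∀ i j, ∀ v, u i v * u' j v = 0 := by
    intro i j v
    by_cases hv : v ∈ S
    · rw [h2' j v (Finset.disjoint_left.1 hST hv), mul_zero]
    · rw [h2 i v hv, zero_mul]
  refine ⟨m + m', Fin.append u u', Fin.append c c', ?_, ?_, ?_, ?_, ?_, ?_⟩
  · intro i
    induction i using Fin.addCases <;> simp [h1, h1']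
  · intro i v hv
    rw [Finset.mem_union, not_or] at hv
    induction i using Fin.addCases <;> simp [h2 _ v hv.1, h2' _ v hv.2]
  · intro i j hij
    induction i using Fin.addCases <;> induction j using Fin.addCases
    · simpa using h3 _ _ (fun h => hij (by rw [h]))
    · simp [key]
    · simp [key, mul_comm (u' _ _)]
    · simpa using h3' _ _ (fun h => hij (by rw [h]))
  · intro i
    induction i using Fin.addCases <;> simp [h4, h4']
  · intro i
    induction i using Fin.addCases
    · simpa using h5 _
    · simpa using h5' _
  · rw [Fin.sum_univ_add]
    simpa using add_le_add h6 h6'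

lemma Certified.le_gNegEnergy {S : Finset V} {w : ℝ} (h : Certified G S w) :
    w ≤ gNegEnergy G 4 := by
  obtain ⟨m, u, c, h1, -, h3, h4, h5, h6⟩ := h
  set hA := adjMatrix_isHermitian G
  set b := hA.eigenvectorBasis
  set f : V → ℝ := fun j => if hA.eigenvalues j < 0 then |hA.eigenvalues j| ^ (4 : ℝ) else 0
    with hf
  let e : Fin m → EuclideanSpace ℝ V := fun i => WithLp.toLp 2 (u i)
  have he0 : ∀ i, e i ≠ 0 := fun i h => h1 i (by simpa [e] using h)
  have hein : ∀ i j, inner ℝ (e i) (e j) = ∑ v, u i v * u j v := by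
    intro i j
    simp [e, PiLp.inner_apply, mul_comm]
  have hform : ∀ i, adjForm G (u i) = ∑ j, hA.eigenvalues j * (inner ℝ (e i) (b j)) ^ 2 := by
    intro i
    have h : adjForm G (u i) = inner ℝ (e i) (WithLp.toLp 2 (G.adjMatrix ℝ *ᵥ u i)) := by
      simp [adjForm, e, PiLp.inner_apply, Matrix.mulVec, dotProduct, Finset.mul_sum,
        SimpleGraph.adjMatrix_apply, mul_comm]
    rw [h, ← b.sum_inner_mul_inner]
    refine Finset.sum_congr rfl fun j _ => ?_
    have h' : inner ℝ (b j) (WithLp.toLp 2 (G.adjMatrix ℝ *ᵥ u i)) =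
        hA.eigenvalues j * inner ℝ (e i) (b j) := by
      have hm := hA.mulVec_eigenvectorBasis j
      have : inner ℝ (b j) (WithLp.toLp 2 (G.adjMatrix ℝ *ᵥ u i)) =
          (G.adjMatrix ℝ *ᵥ ⇑(b j)) ⬝ᵥ u i := by
        rw [EuclideanSpace.inner_eq_star_dotProduct]
        simp only [star_trivial]
        rw [dotProduct_comm, Matrix.dotProduct_mulVec, ← Matrix.mulVec_transpose,
          SimpleGraph.transpose_adjMatrix]
      rw [this, hm, EuclideanSpace.inner_eq_star_dotProduct]
      simp [b, e]
    rw [h']; ring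
  have hpars : ∀ i, ∑ j, (inner ℝ (e i) (b j)) ^ 2 = ∑ v, u i v * u i v := by
    intro i
    rw [← hein, ← b.sum_inner_mul_inner]
    refine Finset.sum_congr rfl fun j _ => ?_
    rw [real_inner_comm (e i) (b j), sq]
  have hNpos : ∀ i, 0 < ∑ v, u i v * u i v := by
    intro i
    rw [← hein]
    exact real_inner_self_pos.2 (he0 i)
  have hbessel : ∀ j, ∑ i, (inner ℝ (e i) (b j)) ^ 2 / ∑ v, u i v * u i v ≤ 1 := by
    intro j
    have hon : Orthonormal ℝ fun i => (‖e i‖⁻¹ : ℝ) • e i := by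
      constructor
      · intro i
        simp [norm_smul, he0 i]
      · intro i i' hi
        simp [inner_smul_left, inner_smul_right, hein, h3 i i' hi]
    have := hon.sum_inner_products_le (x := b j) (s := Finset.univ)
    rw [b.norm_eq_one, one_pow] at this
    refine le_trans (le_of_eq (Finset.sum_congr rfl fun i _ => ?_)) this
    rw [← hein, real_inner_self_eq_norm_sq, inner_smul_left]
    simp [mul_pow, div_eq_inv_mul]
  have hfnn : ∀ j, 0 ≤ f j := by
    intro j
    simp only [hf]
    split_ifs <;> positivity
  have hconv : ∀ i j, -4 * c i ^ 3 * hA.eigenvalues j - 3 * c i ^ 4 ≤ f j := by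
    intro i j
    have hc := h4 i
    simp only [hf]
    split_ifs with h
    · rw [show (4 : ℝ) = ((4 : ℕ) : ℝ) by norm_num, Real.rpow_natCast, abs_of_neg h]
      generalize hA.eigenvalues j = t at *
      have : (-t) ^ 4 + 4 * c i ^ 3 * t + 3 * c i ^ 4 =
        (t + c i) ^ 2 * ((t - c i) ^ 2 + 2 * c i ^ 2) := by ring
      have h0 : 0 ≤ (t + c i) ^ 2 * ((t - c i) ^ 2 + 2 * c i ^ 2) := by positivity
      push_cast
      linarith
    · have := mul_nonneg (pow_nonneg hc 3) (not_lt.1 h)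
      have := pow_nonneg hc 4
      linarith
  calc w ≤ ∑ i, c i ^ 4 := h6
    _ ≤ ∑ i, ∑ j, (inner ℝ (e i) (b j)) ^ 2 / (∑ v, u i v * u i v) * f j := by
        refine Finset.sum_le_sum fun i _ => ?_
        have hN := hNpos i
        have h5i := h5 i
        rw [hform] at h5i
        have : ∑ j, (inner ℝ (e i) (b j)) ^ 2 / (∑ v, u i v * u i v) *
            (-4 * c i ^ 3 * hA.eigenvalues j - 3 * c i ^ 4) ≤
            ∑ j, (inner ℝ (e i) (b j)) ^ 2 / (∑ v, u i v * u i v) * f j :=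
          Finset.sum_le_sum fun j _ => mul_le_mul_of_nonneg_left (hconv i j) (by positivity)
        refine le_trans ?_ this
        have heq : ∑ j, (inner ℝ (e i) (b j)) ^ 2 / (∑ v, u i v * u i v) *
            (-4 * c i ^ 3 * hA.eigenvalues j - 3 * c i ^ 4) =
            (-4 * c i ^ 3 * ∑ j, hA.eigenvalues j * (inner ℝ (e i) (b j)) ^ 2
              - 3 * c i ^ 4 * ∑ j, (inner ℝ (e i) (b j)) ^ 2) / (∑ v, u i v * u i v) := by
          rw [Finset.mul_sum, Finset.mul_sum, ← Finset.sum_sub_distrib, Finset.sum_div]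
          exact Finset.sum_congr rfl fun j _ => by ring
        rw [heq, hpars, le_div_iff₀ hN]
        nlinarith [mul_le_mul_of_nonneg_left h5i (pow_nonneg (h4 i) 3)]
    _ = ∑ j, (∑ i, (inner ℝ (e i) (b j)) ^ 2 / ∑ v, u i v * u i v) * f j := by
        rw [Finset.sum_comm]
        exact Finset.sum_congr rfl fun j _ => by rw [Finset.sum_mul]
    _ ≤ ∑ j, 1 * f j :=
        Finset.sum_le_sum fun j _ => mul_le_mul_of_nonneg_right (hbessel j) (hfnn j)
    _ = gNegEnergy G 4 := by simp only [one_mul]; rfl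

lemma exists_orthogonal_sum_eq_zero (C : Finset V) (hC : C.Nonempty) :
    ∃ (m : ℕ) (u : Fin m → V → ℝ), m + 1 = C.card ∧ (∀ i, u i ≠ 0) ∧
      (∀ i, ∀ v ∉ C, u i v = 0) ∧ (∀ i j, i ≠ j → ∑ v, u i v * u j v = 0) ∧
      (∀ i, ∑ v ∈ C, u i v = 0) := by
  induction hC using Finset.Nonempty.cons_induction with
  | singleton a => exact ⟨0, fun i => i.elim0, by simp⟩
  | cons a C ha hC ih =>
    obtain ⟨m, u, hm, h1, h2, h3, h4⟩ := ih
    set w : V → ℝ := fun v => if v = a then -(C.card : ℝ) else if v ∈ C then 1 else 0 with hw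
    have horth : ∀ i, ∑ v, u i v * w v = 0 := by
      intro i
      rw [sum_eq_sum_of_support (h2 i), ← h4 i]
      refine Finset.sum_congr rfl fun v hv => ?_
      simp [hw, hv, (ne_of_mem_of_not_mem hv ha)]
    have hpos : (0 : ℝ) < C.card := by exact_mod_cast hC.card_pos
    refine ⟨m + 1, Fin.cons w u, by rw [Finset.card_cons, hm], ?_, ?_, ?_, ?_⟩
    · intro i
      refine Fin.cases ?_ (fun i => by simpa using h1 i) i
      intro h
      have := congrFun h a
      simp [hw] at this
      simp [this] at hpos
    · intro i v hv
      simp only [Finset.mem_cons, not_or] at hv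
      refine Fin.cases ?_ (fun i => by simpa using h2 i v hv.2) i
      simp [hw, hv.1, hv.2]
    · intro i j
      refine Fin.cases ?_ (fun i => ?_) i <;> refine Fin.cases ?_ (fun j => ?_) j
      · simp
      · intro _
        simpa [mul_comm] using horth j
      · intro _
        simpa using horth i
      · intro hij
        simpa using h3 i j (fun h => hij (by rw [h]))
    · intro i
      rw [Finset.sum_cons]
      refine Fin.cases ?_ (fun i => by simpa [h2 i a ha] using h4 i) i
      have : ∑ v ∈ C, w v = C.card := by
        rw [Finset.cast_card]
        refine Finset.sum_congr rfl fun v hv => ?_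
        simp [hw, hv, (ne_of_mem_of_not_mem hv ha)]
      simp only [Fin.cons_zero, this]
      simp [hw]

lemma certified_clique {C : Finset V} (hC : C.Nonempty)
    (h : ∀ x ∈ C, ∀ y ∈ C, x ≠ y → G.Adj x y) : Certified G C (C.card - 1) := by
  obtain ⟨m, u, hm, h1, h2, h3, h4⟩ := exists_orthogonal_sum_eq_zero C hC
  refine ⟨m, u, fun _ => 1, h1, h2, h3, fun _ => zero_le_one, fun i => ?_, ?_⟩
  · rw [adjForm_eq_sum (h2 i), sum_eq_sum_of_support (h2 i)]
    have : ∀ x ∈ C, (∑ y ∈ C, if G.Adj x y then u i x * u i y else 0) = -(u i x * u i x) := by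
      intro x hx
      have : ∀ y ∈ C, (if G.Adj x y then u i x * u i y else 0) =
          u i x * u i y - if x = y then u i x * u i y else 0 := by
        intro y hy
        by_cases hxy : x = y
        · simp [hxy]
        · simp [hxy, h x hx y hy hxy]
      rw [Finset.sum_congr rfl this, Finset.sum_sub_distrib, ← Finset.mul_sum, h4]
      simp [hx]
    rw [Finset.sum_congr rfl this]
    simp
  · simp [← hm]

lemma certified_star {b : V} {L : Finset V} (hL : L.Nonempty) (hb : ∀ l ∈ L, G.Adj b l)
    (hind : ∀ l ∈ L, ∀ l' ∈ L, ¬G.Adj l l') :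
    Certified G (insert b L) ((L.card : ℝ) ^ 2) := by
  have hbL : b ∉ L := fun h => G.irrefl (hb b h)
  set r : ℝ := √(L.card : ℝ)
  have hr : r * r = L.card := Real.mul_self_sqrt (by positivity)
  set u : V → ℝ := fun v => if v = b then -r else if v ∈ L then 1 else 0 with hu
  have hub : u b = -r := by simp [hu]
  have huL : ∀ l ∈ L, u l = 1 := fun l hl => by simp [hu, hl, ne_of_mem_of_not_mem hl hbL]
  have h2 : ∀ v ∉ insert b L, u v = 0 := by
    intro v hv
    simp only [Finset.mem_insert, not_or] at hv
    simp [hu, hv.1, hv.2]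
  refine ⟨1, fun _ => u, fun _ => r, fun _ h => ?_, fun _ => h2, fun i j hij => ?_,
    fun _ => Real.sqrt_nonneg _, fun _ => ?_, ?_⟩
  · obtain ⟨l, hl⟩ := hL
    have := congrFun h l
    simp [huL l hl] at this
  · exact absurd (Subsingleton.elim i j) hij
  · rw [adjForm_eq_sum h2, sum_eq_sum_of_support h2]
    simp only [Finset.sum_insert hbL, hub]
    have e1 : ∑ l ∈ L, u l * u l = L.card := by
      rw [Finset.cast_card]
      exact Finset.sum_congr rfl fun l hl => by simp [huL l hl]
    have e2 : (∑ l ∈ L, if G.Adj b l then -r * u l else 0) = -r * L.card := by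
      rw [Finset.cast_card, Finset.mul_sum]
      exact Finset.sum_congr rfl fun l hl => by simp [huL l hl, hb l hl]
    have e3 : (∑ l ∈ L, ((if G.Adj l b then u l * -r else 0) +
        ∑ l' ∈ L, if G.Adj l l' then u l * u l' else 0)) = -r * L.card := by
      rw [Finset.cast_card, Finset.mul_sum]
      refine Finset.sum_congr rfl fun l hl => ?_
      rw [Finset.sum_eq_zero fun l' hl' => by simp [hind l hl l' hl']]
      simp [huL l hl, (hb l hl).symm]
    rw [e1, e2, e3]
    simp only [G.irrefl, if_false, neg_mul_neg, hr]
    exact le_of_eq (by ring)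
  · simp only [Finset.univ_unique, Finset.sum_const, Finset.card_singleton, one_smul]
    rw [← hr]
    exact le_of_eq (by ring)

variable (G) in
/-- `a`, `b`, `c` induce a path with middle vertex `b`. -/
def InducedPath (a b c : V) : Prop := G.Adj a b ∧ G.Adj b c ∧ ¬G.Adj a c ∧ a ≠ c

variable (G) in
/-- No two vertices of `R` are adjacent. -/
def Independent (R : Finset V) : Prop := ∀ x ∈ R, ∀ y ∈ R, ¬G.Adj x y

variable (G) in
/-- Every proper nonempty subset of `S` is joined by an edge to the rest of `S`. -/
def ConnectedOn (S : Finset V) : Prop :=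
  ∀ C ⊆ S, C.Nonempty → C ≠ S → ∃ x ∈ C, ∃ y ∈ S, y ∉ C ∧ G.Adj x y

lemma exists_representatives (P : Finset V) : ∀ T : Finset V,
    (∀ a ∈ T, ∀ b ∈ T, ∀ c ∈ T, ¬InducedPath G a b c) →
    (∀ t ∈ T, ∃ x ∈ T, (x = t ∨ G.Adj x t) ∧ ∃ s ∈ P, G.Adj x s) →
    ∃ R ⊆ T, Independent G R ∧ (∀ r ∈ R, ∃ s ∈ P, G.Adj r s) ∧
      (∀ I ⊆ T, Independent G I → I.card ≤ R.card) ∧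
      Certified G T ((T.card : ℝ) - R.card) := by
  intro T
  induction T using Finset.strongInduction with
  | H T ih =>
  intro hfree hatt
  rcases T.eq_empty_or_nonempty with rfl | ⟨t, ht⟩
  · exact ⟨∅, by simp, by simp [Independent], by simp, fun I hI _ => Finset.card_le_card hI,
      0, fun i => i.elim0, fun i => i.elim0, by simp⟩
  obtain ⟨x, hx, -, hxP⟩ := hatt t ht
  set C := T.filter fun y => y = x ∨ G.Adj x y with hC
  have hxC : x ∈ C := by simp [hC, hx]
  have hCT : C ⊆ T := Finset.filter_subset _ _
  have hclique : ∀ y ∈ C, ∀ z ∈ C, y ≠ z → G.Adj y z := by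
    intro y hy z hz hyz
    rw [hC, Finset.mem_filter] at hy hz
    by_contra hn
    rcases hy.2 with rfl | h1
    · rcases hz.2 with rfl | h2
      · exact hyz rfl
      · exact hn h2
    · rcases hz.2 with rfl | h2
      · exact hn h1.symm
      · exact hfree y hy.1 x hx z hz.1 ⟨h1.symm, h2, hn, hyz⟩
  have hsep : ∀ y ∈ C, ∀ z ∈ T, G.Adj y z → z ∈ C := by
    intro y hy z hz hyz
    rw [hC, Finset.mem_filter] at hy ⊢
    refine ⟨hz, ?_⟩
    by_contra hn
    rw [not_or] at hn
    rcases hy.2 with rfl | h1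
    · exact hn.2 hyz
    · exact hfree x hx y hy.1 z hz ⟨h1, hyz, hn.2, fun h => hn.1 h.symm⟩
  obtain ⟨R, hRT, hRind, hRP, hRmax, hRcert⟩ := ih (T \ C)
    (Finset.sdiff_ssubset hCT ⟨x, hxC⟩)
    (fun a ha b hb c hc => hfree a (Finset.mem_sdiff.1 ha).1 b (Finset.mem_sdiff.1 hb).1 c
      (Finset.mem_sdiff.1 hc).1)
    (fun t' ht' => by
      obtain ⟨ht'T, ht'C⟩ := Finset.mem_sdiff.1 ht'
      obtain ⟨y, hy, hyt, hyP⟩ := hatt t' ht'T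
      refine ⟨y, Finset.mem_sdiff.2 ⟨hy, fun hyC => ht'C ?_⟩, hyt, hyP⟩
      rcases hyt with rfl | hyt
      · exact hyC
      · exact hsep y hyC t' ht'T hyt)
  have hxR : x ∉ R := fun h => (Finset.mem_sdiff.1 (hRT h)).2 hxC
  have hxRadj : ∀ r ∈ R, ¬G.Adj x r := fun r hr h =>
    (Finset.mem_sdiff.1 (hRT hr)).2 (hsep x hxC r (Finset.mem_sdiff.1 (hRT hr)).1 h)
  refine ⟨insert x R, ?_, ?_, ?_, ?_, ?_⟩
  · exact Finset.insert_subset hx (hRT.trans Finset.sdiff_subset)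
  · intro y hy z hz hyz
    rw [Finset.mem_insert] at hy hz
    rcases hy with rfl | hy <;> rcases hz with rfl | hz
    · exact G.irrefl hyz
    · exact hxRadj _ hz hyz
    · exact hxRadj _ hy hyz.symm
    · exact hRind y hy z hz hyz
  · intro r hr
    rcases Finset.mem_insert.1 hr with rfl | hr
    · exact hxP
    · exact hRP r hr
  · intro I hI hIind
    have h1 := hRmax (I \ C) (Finset.sdiff_subset_sdiff hI le_rfl)
      (fun y hy z hz => hIind y (Finset.mem_sdiff.1 hy).1 z (Finset.mem_sdiff.1 hz).1)
    have h2 : (I ∩ C).card ≤ 1 := by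
      rw [Finset.card_le_one]
      intro y hy z hz
      rw [Finset.mem_inter] at hy hz
      by_contra hyz
      exact hIind y hy.1 z hz.1 (hclique y hy.2 z hz.2 hyz)
    have h3 := Finset.card_sdiff_add_card_inter I C
    rw [Finset.card_insert_of_notMem hxR]
    omega
  · have := (certified_clique ⟨x, hxC⟩ hclique).union hRcert Finset.disjoint_sdiff
    rw [Finset.union_sdiff_of_subset hCT] at this
    refine this.mono (le_of_eq ?_)
    have hcard := Finset.card_sdiff_add_card_eq_card hCT
    rw [Finset.card_insert_of_notMem hxR, ← hcard]
    push_cast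
    ring

lemma exists_attached_representatives {S P : Finset V} (hS : ConnectedOn G S) (hPS : P ⊆ S)
    (hP : P.Nonempty)
    (hfree : ∀ a ∈ S \ P, ∀ b ∈ S \ P, ∀ c ∈ S \ P, ¬InducedPath G a b c) :
    ∃ R ⊆ S \ P, Independent G R ∧ (∀ r ∈ R, ∃ s ∈ P, G.Adj r s) ∧
      (∀ I ⊆ S \ P, Independent G I → I.card ≤ R.card) ∧
      ∀ w : ℝ, Certified G P w → (P.card : ℝ) + R.card ≤ w → Certified G S S.card := by
  obtain ⟨R, h1, h2, h3, h4, h5⟩ := exists_representatives P (S \ P) hfree (by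
    intro t ht
    set C := (S \ P).filter fun y => y = t ∨ G.Adj t y with hC
    obtain ⟨p, hp⟩ := hP
    obtain ⟨x, hx, y, hyS, hyC, hxy⟩ := hS C
      ((Finset.filter_subset _ _).trans Finset.sdiff_subset) ⟨t, by simp [hC, -Finset.mem_sdiff, ht]⟩
      (fun h => by
        have : p ∈ C := h ▸ hPS hp
        exact (Finset.mem_sdiff.1 (Finset.mem_filter.1 this).1).2 hp)
    rw [hC, Finset.mem_filter] at hx hyC
    refine ⟨x, hx.1, hx.2.imp id SimpleGraph.Adj.symm, y, ?_, hxy⟩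
    by_contra hyP
    have hy : y ∈ S \ P := Finset.mem_sdiff.2 ⟨hyS, hyP⟩
    have hyC : ¬(y = t ∨ G.Adj t y) := fun h => hyC ⟨hy, h⟩
    rw [not_or] at hyC
    rcases hx.2 with rfl | htx
    · exact hyC.2 hxy
    · exact hfree t ht x hx.1 y hy ⟨htx, hxy, hyC.2, fun h => hyC.1 h.symm⟩)
  refine ⟨R, h1, h2, h3, h4, fun w hw hle => ?_⟩
  have := hw.union h5 Finset.disjoint_sdiff
  rw [Finset.union_sdiff_of_subset hPS] at this
  refine this.mono ?_
  have hcard := Finset.card_sdiff_add_card_eq_card hPS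
  rw [← hcard]
  push_cast
  linarith

omit [Fintype V] in
lemma ConnectedOn.insert_of_adj {S : Finset V} (hS : ConnectedOn G S) {x z : V} (hx : x ∈ S)
    (hxz : G.Adj x z) : ConnectedOn G (insert z S) := by
  intro C hC hne hCS
  by_cases hz : z ∈ C
  · by_cases hxC : x ∈ C
    · have hss : S \ C ≠ ∅ := by
        intro h
        refine hCS (hC.antisymm (Finset.insert_subset hz (Finset.sdiff_eq_empty_iff_subset.1 h)))
      obtain ⟨a, ha, b, hb, hbC, hab⟩ := hS (S \ C) Finset.sdiff_subset
        (Finset.nonempty_iff_ne_empty.2 hss) (fun h => by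
          have : x ∈ S \ C := by rw [h]; exact hx
          exact (Finset.mem_sdiff.1 this).2 hxC)
      have hbC' : b ∈ C := by
        by_contra h
        exact hbC (Finset.mem_sdiff.2 ⟨hb, h⟩)
      exact ⟨b, hbC', a, Finset.mem_insert_of_mem (Finset.mem_sdiff.1 ha).1,
        (Finset.mem_sdiff.1 ha).2, hab.symm⟩
    · exact ⟨z, hz, x, Finset.mem_insert_of_mem hx, hxC, hxz.symm⟩
  · have hCS' : C ⊆ S := (Finset.subset_insert_iff_of_notMem hz).1 hC
    by_cases h : C = S
    · exact ⟨x, h ▸ hx, z, Finset.mem_insert_self _ _, hz, hxz⟩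
    · obtain ⟨a, ha, b, hb, hbC, hab⟩ := hS C hCS' hne h
      exact ⟨a, ha, b, Finset.mem_insert_of_mem hb, hbC, hab⟩

omit [Fintype V] in
lemma ConnectedOn.exists_partition {S : Finset V} (hS : ConnectedOn G S) :
    ∀ (k : ℕ) (X Y : Finset V), (S \ (X ∪ Y)).card = k → X ⊆ S → Y ⊆ S → X.Nonempty →
      Disjoint X Y → ConnectedOn G X → ConnectedOn G Y →
      ∃ X' Y', X ⊆ X' ∧ Y ⊆ Y' ∧ Disjoint X' Y' ∧ X' ∪ Y' = S ∧
        ConnectedOn G X' ∧ ConnectedOn G Y' := by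
  intro k
  induction k with
  | zero =>
    intro X Y hk hX hY _ hd hcX hcY
    exact ⟨X, Y, le_rfl, le_rfl, hd, (Finset.union_subset hX hY).antisymm
      (Finset.sdiff_eq_empty_iff_subset.1 (Finset.card_eq_zero.1 hk)), hcX, hcY⟩
  | succ k ih =>
    intro X Y hk hX hY hne hd hcX hcY
    obtain ⟨x, hx, z, hzS, hz, hxz⟩ := hS (X ∪ Y) (Finset.union_subset hX hY)
      (hne.mono Finset.subset_union_left) (fun h => by simp [h] at hk)
    have hcard : (S \ insert z (X ∪ Y)).card = k := by
      have hmem : z ∈ S \ (X ∪ Y) := Finset.mem_sdiff.2 ⟨hzS, hz⟩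
      rw [Finset.sdiff_insert, Finset.card_erase_of_mem hmem, hk, Nat.add_sub_cancel]
    rw [Finset.mem_union, not_or] at hz
    rcases Finset.mem_union.1 hx with hx | hx
    · obtain ⟨X', Y', h1, h2, h3⟩ := ih (insert z X) Y (by rwa [Finset.insert_union])
        (Finset.insert_subset hzS hX) hY (Finset.insert_nonempty _ _)
        (Finset.disjoint_insert_left.2 ⟨hz.2, hd⟩) (hcX.insert_of_adj hx hxz) hcY
      exact ⟨X', Y', (Finset.subset_insert _ _).trans h1, h2, h3⟩
    · obtain ⟨X', Y', h1, h2, h3⟩ := ih X (insert z Y) (by rwa [Finset.union_insert])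
        hX (Finset.insert_subset hzS hY) hne
        (Finset.disjoint_insert_right.2 ⟨hz.1, hd⟩) hcX (hcY.insert_of_adj hx hxz)
      exact ⟨X', Y', h1, (Finset.subset_insert _ _).trans h2, h3⟩

omit [Fintype V] in
lemma InducedPath.connectedOn {a b c : V} (h : InducedPath G a b c) :
    ConnectedOn G {a, b, c} := by
  have h0 : ConnectedOn G {b} := by
    intro C hC hne hCb
    exact absurd (Finset.Nonempty.subset_singleton_iff hne |>.1 hC) hCb
  have h1 := (h0.insert_of_adj (Finset.mem_singleton_self b) h.2.1).insert_of_adj (z := a) (x := b)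
    (by simp) h.1.symm
  rwa [Finset.pair_comm c b] at h1

omit [Fintype V] in
lemma ConnectedOn.exists_inducedPath {S : Finset V} (hS : ConnectedOn G S) {x y : V}
    (hx : x ∈ S) (hy : y ∈ S) (hxy : x ≠ y) (hn : ¬G.Adj x y) :
    ∃ a ∈ S, ∃ b ∈ S, ∃ c ∈ S, InducedPath G a b c := by
  set C := S.filter fun v => v = x ∨ G.Adj x v with hC
  obtain ⟨u, hu, w, hwS, hwC, huw⟩ := hS C (Finset.filter_subset _ _) ⟨x, by simp [hC, hx]⟩
    (fun h => by
      have : y ∈ C := h ▸ hy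
      rcases (Finset.mem_filter.1 this).2 with rfl | h'
      · exact hxy rfl
      · exact hn h')
  rw [hC, Finset.mem_filter] at hu hwC
  have hw : ¬(w = x ∨ G.Adj x w) := fun h => hwC ⟨hwS, h⟩
  rw [not_or] at hw
  rcases hu.2 with rfl | hxu
  · exact absurd huw hw.2
  · exact ⟨x, hx, u, hu.1, w, hwS, hxu, huw, hw.2, fun h => hw.1 h.symm⟩

omit [DecidableEq V] in
lemma certified_of_tuple {S : Finset V} {k m : ℕ} (p : Fin k → V) (hp : p.Injective)
    (hpS : ∀ s, p s ∈ S) (w : Fin m → Fin k → ℝ) (c : Fin m → ℝ) (hw : ∀ i, w i ≠ 0)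
    (horth : ∀ i j, i < j → ∑ s, w i s * w j s = 0) (hc : ∀ i, 0 ≤ c i)
    (hform : ∀ i, ∑ s, ∑ t, (if G.Adj (p s) (p t) then w i s * w i t else 0) ≤
      -c i * ∑ s, w i s * w i s) : Certified G S (∑ i, c i ^ 4) := by
  set u : Fin m → V → ℝ := fun i => Function.extend p (w i) 0 with hu
  have hup : ∀ i s, u i (p s) = w i s := fun i s => hp.extend_apply _ _ _
  have hu0 : ∀ i, ∀ v ∉ Finset.univ.map ⟨p, hp⟩, u i v = 0 := fun i v hv =>
    Function.extend_apply' _ _ _ fun ⟨s, hs⟩ => hv (by simp [← hs])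
  have hsum : ∀ i j, ∑ v, u i v * u j v = ∑ s, w i s * w j s := fun i j => by
    rw [sum_eq_sum_of_support (hu0 i), Finset.sum_map]
    simp [hup]
  refine ⟨m, u, c, fun i h => hw i ?_, fun i v hv => hu0 i v ?_, fun i j hij => ?_, hc,
    fun i => ?_, le_rfl⟩
  · ext s
    rw [← hup, h]
    rfl
  · intro h
    obtain ⟨s, -, rfl⟩ := Finset.mem_map.1 h
    exact hv (hpS s)
  · rw [hsum]
    rcases lt_or_gt_of_ne hij with h | h
    · exact horth i j h
    · simpa only [mul_comm] using horth j i h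
  · rw [hsum, adjForm_eq_sum (hu0 i), Finset.sum_map]
    simpa [Finset.sum_map, hup] using hform i

lemma certified_path_four {x a b c : V} (hxa : G.Adj x a) (hab : G.Adj a b) (hbc : G.Adj b c)
    (hac : ¬G.Adj a c) (hxb : ¬G.Adj x b) (hxc : ¬G.Adj x c) (nxb : x ≠ b) (nxc : x ≠ c)
    (nac : a ≠ c) : Certified G {x, a, b, c} 7 := by
  have n1 := hxa.ne
  have n2 := hab.ne
  have n3 := hbc.ne
  set φ := Real.goldenRatio
  have hφ : φ ^ 2 = φ + 1 := Real.goldenRatio_sq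
  have hφ1 : 1 < φ := Real.one_lt_goldenRatio
  refine (certified_of_tuple ![x, a, b, c] ?_ ?_ ![![1, -φ, φ, -1], ![φ, -1, -1, φ]]
    ![φ, φ - 1] ?_ ?_ ?_ ?_).mono ?_
  · intro s t
    fin_cases s <;> fin_cases t <;> simp [*, Ne.symm]
  · intro s
    fin_cases s <;> simp
  · simp [Fin.forall_fin_succ]
  · simp [Fin.forall_fin_succ, Fin.sum_univ_succ]
  · simp [Fin.forall_fin_succ]
    constructor <;> linarith
  · simp only [Fin.forall_fin_two]
    simp [Fin.sum_univ_succ, hxa, hab, hbc, hac, hxb, hxc, hxa.symm, hab.symm, hbc.symm,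
      G.adj_comm c a, G.adj_comm b x, G.adj_comm c x]
    constructor <;> nlinarith
  · simp [Fin.sum_univ_succ]
    nlinarith

lemma certified_cycle_four {x a b c : V} (hxa : G.Adj x a) (hab : G.Adj a b) (hbc : G.Adj b c)
    (hac : ¬G.Adj a c) (hxb : ¬G.Adj x b) (hxc : G.Adj x c) (nxb : x ≠ b)
    (nac : a ≠ c) : Certified G {x, a, b, c} 7 := by
  have n1 := hxa.ne
  have n2 := hab.ne
  have n3 := hbc.ne
  have n4 := hxc.ne
  refine (certified_of_tuple ![x, a, b, c] ?_ ?_ ![![1, -1, 1, -1]] ![2] ?_ ?_ ?_ ?_).mono ?_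
  · intro s t
    fin_cases s <;> fin_cases t <;> simp [*, Ne.symm]
  · intro s
    fin_cases s <;> simp
  · simp
  · simp
  · simp
  · simp [Fin.sum_univ_succ, hxa, hab, hbc, hac, hxb, hxc, hxa.symm, hab.symm, hbc.symm,
      G.adj_comm c a, G.adj_comm b x, G.adj_comm c x]
    norm_num
  · norm_num

lemma certified_diamond {x a b c : V} (hxa : G.Adj x a) (hab : G.Adj a b) (hbc : G.Adj b c)
    (hac : ¬G.Adj a c) (hxb : G.Adj x b) (hxc : G.Adj x c) (nac : a ≠ c) :
    Certified G {x, a, b, c} 6 := by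
  have n1 := hxa.ne
  have n2 := hab.ne
  have n3 := hbc.ne
  have n4 := hxc.ne
  have n5 := hxb.ne
  refine (certified_of_tuple ![x, a, b, c] ?_ ?_ ![![1, -1, 1, -1], ![1, 0, -1, 0]]
    ![3 / 2, 1] ?_ ?_ ?_ ?_).mono ?_
  · intro s t
    fin_cases s <;> fin_cases t <;> simp [*, Ne.symm]
  · intro s
    fin_cases s <;> simp
  · simp [Fin.forall_fin_succ]
  · simp [Fin.forall_fin_succ, Fin.sum_univ_succ]
  · simp [Fin.forall_fin_succ]
    norm_num
  · simp only [Fin.forall_fin_two]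
    simp [Fin.sum_univ_succ, hxa, hab, hbc, hac, hxb, hxc, hxa.symm, hab.symm, hbc.symm,
      G.adj_comm c a, G.adj_comm b x, G.adj_comm c x]
    norm_num
  · simp [Fin.sum_univ_succ]
    norm_num

lemma certified_butterfly {x y a b c : V} (hab : G.Adj a b) (hbc : G.Adj b c)
    (hac : ¬G.Adj a c) (hxb : G.Adj x b) (hyb : G.Adj y b) (hxa : G.Adj x a) (hyc : G.Adj y c)
    (hxy : ¬G.Adj x y) (hxc : ¬G.Adj x c) (hya : ¬G.Adj y a) (nac : a ≠ c) (nxy : x ≠ y)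
    (nxc : x ≠ c) (nya : y ≠ a) : Certified G {x, y, a, b, c} 7 := by
  have n1 := hxa.ne
  have n2 := hab.ne
  have n3 := hbc.ne
  have n4 := hyc.ne
  have n5 := hxb.ne
  have n6 := hyb.ne
  refine (certified_of_tuple ![x, y, a, b, c] ?_ ?_
    ![![1, 1, 1, -2, 1], ![1, 0, -1, 0, 0], ![0, 1, 0, 0, -1]] ![3 / 2, 1, 1] ?_ ?_ ?_ ?_).mono ?_
  · intro s t
    fin_cases s <;> fin_cases t <;> simp [*, Ne.symm]
  · intro s
    fin_cases s <;> simp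
  · simp [Fin.forall_fin_succ]
  · simp [Fin.forall_fin_succ, Fin.sum_univ_succ]
  · simp [Fin.forall_fin_succ]
    norm_num
  · simp only [Fin.forall_fin_succ]
    simp [Fin.sum_univ_succ, hxa, hab, hbc, hac, hxb, hxc, hyb, hyc, hxy, hya, hxa.symm, hab.symm,
      hbc.symm, hxb.symm, hyb.symm, hyc.symm,
      G.adj_comm c a, G.adj_comm c x, G.adj_comm y x, G.adj_comm a y]
    norm_num
  · simp [Fin.sum_univ_succ]
    norm_num

lemma certified_of_independent_card_le {S P : Finset V} {k p : ℕ} {w : ℝ} (hS : ConnectedOn G S)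
    (hPS : P ⊆ S) (hP : P.Nonempty)
    (hfree : ∀ a ∈ S \ P, ∀ b ∈ S \ P, ∀ c ∈ S \ P, ¬InducedPath G a b c)
    (hk : ∀ I ⊆ S \ P, Independent G I → I.card ≤ k) (hp : P.card ≤ p) (hw : Certified G P w)
    (hle : (p : ℝ) + k ≤ w) : Certified G S S.card := by
  obtain ⟨R, h1, h2, -, -, h5⟩ := exists_attached_representatives hS hPS hP hfree
  refine h5 w hw (le_trans ?_ hle)
  have := hk R h1 h2
  gcongr

variable (G) in
/-- Any two induced paths on three vertices of `S` share a vertex. -/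
def PathsIntersect (S : Finset V) : Prop :=
  ∀ a ∈ S, ∀ b ∈ S, ∀ c ∈ S, InducedPath G a b c →
    ∀ a' ∈ S, ∀ b' ∈ S, ∀ c' ∈ S, InducedPath G a' b' c' →
      ¬Disjoint ({a, b, c} : Finset V) {a', b', c'}

omit [Fintype V] in
lemma PathsIntersect.not_inducedPath_sdiff {S P : Finset V} (hI : PathsIntersect G S) {a b c : V}
    (hPS : P ⊆ S) (ha : a ∈ P) (hb : b ∈ P) (hc : c ∈ P) (h : InducedPath G a b c) :
    ∀ a' ∈ S \ P, ∀ b' ∈ S \ P, ∀ c' ∈ S \ P, ¬InducedPath G a' b' c' := by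
  intro a' ha' b' hb' c' hc' h'
  rw [Finset.mem_sdiff] at ha' hb' hc'
  refine hI a (hPS ha) b (hPS hb) c (hPS hc) h a' ha'.1 b' hb'.1 c' hc'.1 h' ?_
  refine Disjoint.mono_left (b := P) ?_ ?_
  · simp [Finset.insert_subset_iff, ha, hb, hc]
  · simp [ha'.2, hb'.2, hc'.2]

lemma certified_of_claw {S L₀ : Finset V} (hS : ConnectedOn G S) (hI : PathsIntersect G S)
    {b : V} (hb : b ∈ S) (hL₀S : L₀ ⊆ S) (hbL₀ : ∀ l ∈ L₀, G.Adj b l) (hL₀ : Independent G L₀)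
    (hcard : 3 ≤ L₀.card) : Certified G S S.card := by
  obtain ⟨L, hL, hLmax⟩ := Finset.exists_max_image
    ((S.filter (G.Adj b)).powerset.filter (Independent G)) Finset.card
    ⟨L₀, by
      simp only [Finset.mem_filter, Finset.mem_powerset]
      exact ⟨fun l hl => Finset.mem_filter.2 ⟨hL₀S hl, hbL₀ l hl⟩, hL₀⟩⟩
  have hmem : ∀ L', L' ∈ (S.filter (G.Adj b)).powerset.filter (Independent G) ↔
      (∀ l ∈ L', l ∈ S ∧ G.Adj b l) ∧ Independent G L' := by
    intro L'
    simp [Finset.subset_iff]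
  have h3 : 3 ≤ L.card := hcard.trans
    (hLmax L₀ ((hmem L₀).2 ⟨fun l hl => ⟨hL₀S hl, hbL₀ l hl⟩, hL₀⟩))
  obtain ⟨hLb, hLind⟩ := (hmem L).1 hL
  have hbL : b ∉ L := fun h => G.irrefl (hLb b h).2
  have hpath : ∀ l ∈ L, ∀ l' ∈ L, l ≠ l' → InducedPath G l b l' := fun l hl l' hl' hne =>
    ⟨(hLb l hl).2.symm, (hLb l' hl').2, hLind l hl l' hl', hne⟩
  have hPS : insert b L ⊆ S := Finset.insert_subset hb fun l hl => (hLb l hl).1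
  obtain ⟨l₁, hl₁, l₂, hl₂, h12⟩ := Finset.one_lt_card.1 (show 1 < L.card by omega)
  obtain ⟨R, hR, hRind, hRatt, -, hRcert⟩ := exists_attached_representatives hS hPS
    (Finset.insert_nonempty _ _) (hI.not_inducedPath_sdiff hPS (Finset.mem_insert_of_mem hl₁)
      (Finset.mem_insert_self _ _) (Finset.mem_insert_of_mem hl₂) (hpath l₁ hl₁ l₂ hl₂ h12))
  have hRS : ∀ r ∈ R, r ∈ S ∧ r ≠ b ∧ r ∉ L := by
    intro r hr
    have := hR hr
    simp only [Finset.mem_sdiff, Finset.mem_insert, not_or] at this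
    exact this
  have hleaf : ∀ l ∈ L, ∀ r ∈ R, ∀ r' ∈ R, G.Adj r l → G.Adj r' l → r = r' := by
    intro l hl r hr r' hr' hrl hrl'
    by_contra hne
    obtain ⟨m₁, hm₁, m₂, hm₂, h12⟩ := Finset.one_lt_card.1
      (show 1 < (L.erase l).card by rw [Finset.card_erase_of_mem hl]; omega)
    rw [Finset.mem_erase] at hm₁ hm₂
    refine hI r (hRS r hr).1 l (hLb l hl).1 r' (hRS r' hr').1
      ⟨hrl, hrl'.symm, hRind r hr r' hr', hne⟩ m₁ (hLb m₁ hm₁.2).1 b hb m₂ (hLb m₂ hm₂.2).1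
      (hpath m₁ hm₁.2 m₂ hm₂.2 h12) ?_
    have hlb : l ≠ b := fun h => hbL (h ▸ hl)
    have e1 : r ≠ m₁ := fun h => (hRS r hr).2.2 (h ▸ hm₁.2)
    have e2 : r ≠ m₂ := fun h => (hRS r hr).2.2 (h ▸ hm₂.2)
    have e3 : r' ≠ m₁ := fun h => (hRS r' hr').2.2 (h ▸ hm₁.2)
    have e4 : r' ≠ m₂ := fun h => (hRS r' hr').2.2 (h ▸ hm₂.2)
    simp [hm₁.1, hm₂.1, e1.symm, e2.symm, e3.symm, e4.symm, hlb.symm, (hRS r hr).2.1.symm,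
      (hRS r' hr').2.1.symm]
  have hex : ∀ r ∈ R, ¬G.Adj b r → ∃ l ∈ L, G.Adj r l := by
    intro r hr hbr
    obtain ⟨s, hs, hrs⟩ := hRatt r hr
    rcases Finset.mem_insert.1 hs with rfl | hs
    · exact absurd hrs.symm hbr
    · exact ⟨s, hs, hrs⟩
  choose! g hgL hgadj using hex
  set h : V → V := fun r => if G.Adj b r then r else g r with hh
  have hpos : ∀ r, G.Adj b r → h r = r := fun r hr => by simp [hh, hr]
  have hneg : ∀ r, ¬G.Adj b r → h r = g r := fun r hr => by simp [hh, hr]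
  have hinj : ∀ r ∈ R, ∀ r' ∈ R, (h r = h r' → r = r') ∧ ¬G.Adj (h r) (h r') := by
    intro r hr r' hr'
    by_cases h1 : G.Adj b r <;> by_cases h2 : G.Adj b r'
    · rw [hpos r h1, hpos r' h2]
      exact ⟨id, hRind r hr r' hr'⟩
    · rw [hpos r h1, hneg r' h2]
      refine ⟨fun e => absurd (hgL r' hr' h2) (e ▸ (hRS r hr).2.2), fun hadj => ?_⟩
      have := hleaf _ (hgL r' hr' h2) r hr r' hr' hadj (hgadj r' hr' h2)
      exact h2 (this ▸ h1)
    · rw [hneg r h1, hpos r' h2]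
      refine ⟨fun e => absurd (hgL r hr h1) (e ▸ (hRS r' hr').2.2), fun hadj => ?_⟩
      have := hleaf _ (hgL r hr h1) r hr r' hr' (hgadj r hr h1) hadj.symm
      exact h1 (this ▸ h2)
    · rw [hneg r h1, hneg r' h2]
      refine ⟨fun e => ?_, hLind _ (hgL r hr h1) _ (hgL r' hr' h2)⟩
      exact hleaf _ (hgL r hr h1) r hr r' hr' (hgadj r hr h1) (e ▸ hgadj r' hr' h2)
  have hRcard : R.card ≤ L.card := by
    rw [← Finset.card_image_of_injOn (f := h) fun r hr r' hr' => (hinj r hr r' hr').1]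
    refine hLmax _ ((hmem _).2 ⟨?_, ?_⟩)
    · intro v hv
      obtain ⟨r, hr, rfl⟩ := Finset.mem_image.1 hv
      by_cases h1 : G.Adj b r
      · rw [hpos r h1]
        exact ⟨(hRS r hr).1, h1⟩
      · rw [hneg r h1]
        exact hLb _ (hgL r hr h1)
    · intro v hv v' hv'
      obtain ⟨r, hr, rfl⟩ := Finset.mem_image.1 hv
      obtain ⟨r', hr', rfl⟩ := Finset.mem_image.1 hv'
      exact (hinj r hr r' hr').2
  refine hRcert _ (certified_star ⟨l₁, hl₁⟩ (fun l hl => (hLb l hl).2) hLind) ?_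
  rw [Finset.card_insert_of_notMem hbL]
  have h3' : (3 : ℝ) ≤ L.card := by exact_mod_cast h3
  have hRc : (R.card : ℝ) ≤ L.card := by exact_mod_cast hRcard
  push_cast
  nlinarith

lemma certified_of_neighbor_of_end {S : Finset V} (hS : ConnectedOn G S)
    (hI : PathsIntersect G S) {a b c x : V} (ha : a ∈ S) (hb : b ∈ S) (hc : c ∈ S)
    (h : InducedPath G a b c)
    (hk : ∀ I ⊆ S, a ∉ I → b ∉ I → c ∉ I → Independent G I → I.card ≤ 3)
    (hx : x ∈ S) (hxb : x ≠ b) (hxc : x ≠ c) (hxa : G.Adj x a) (hxb' : ¬G.Adj x b) :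
    Certified G S S.card := by
  have hPS : ({x, a, b, c} : Finset V) ⊆ S := by
    simp [Finset.insert_subset_iff, ha, hb, hc, hx]
  refine certified_of_independent_card_le (k := 3) (w := 7) hS hPS (Finset.insert_nonempty _ _)
    (hI.not_inducedPath_sdiff hPS (by simp) (by simp) (by simp) h) ?_ Finset.card_le_four ?_
    (by norm_num)
  · intro I hIS hind
    refine hk I (hIS.trans Finset.sdiff_subset) ?_ ?_ ?_ hind <;>
    · intro hm
      simpa using hIS hm
  · by_cases hxc' : G.Adj x c
    · exact certified_cycle_four hxa h.1 h.2.1 h.2.2.1 hxb' hxc' hxb h.2.2.2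
    · exact certified_path_four hxa h.1 h.2.1 h.2.2.1 hxb' hxc' hxb hxc h.2.2.2

lemma certified_of_claw_free {S : Finset V} (hS : ConnectedOn G S) (hI : PathsIntersect G S)
    (hclaw : ∀ b ∈ S, ∀ L ⊆ S, (∀ l ∈ L, G.Adj b l) → Independent G L → L.card ≤ 2)
    {a b c : V} (ha : a ∈ S) (hb : b ∈ S) (hc : c ∈ S) (h : InducedPath G a b c) :
    Certified G S S.card := by
  have hclaw3 : ∀ b ∈ S, ∀ x ∈ S, ∀ y ∈ S, ∀ z ∈ S, G.Adj b x → G.Adj b y → G.Adj b z →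
      x ≠ y → x ≠ z → y ≠ z → ¬G.Adj x y → ¬G.Adj x z → G.Adj y z := by
    intro b hb x hx y hy z hz hbx hby hbz nxy nxz nyz hxy hxz
    by_contra hyz
    have := hclaw b hb {x, y, z} (by simp [Finset.insert_subset_iff, hx, hy, hz])
      (by simp [hbx, hby, hbz])
      (by simp [Independent, hxy, hxz, hyz, G.adj_comm y x, G.adj_comm z x, G.adj_comm z y])
    rw [Finset.card_eq_three.2 ⟨x, y, z, nxy, nxz, nyz, rfl⟩] at this
    omega
  obtain ⟨hab, hbc, hac, nac⟩ := id h
  have hPS : ({a, b, c} : Finset V) ⊆ S := by simp [Finset.insert_subset_iff, ha, hb, hc]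
  obtain ⟨R, hR, hRind, hRatt, hRmax, hRcert⟩ := exists_attached_representatives hS hPS
    (Finset.insert_nonempty _ _)
    (hI.not_inducedPath_sdiff hPS (by simp) (by simp) (by simp) h)
  have hRS : ∀ r ∈ R, r ∈ S ∧ r ≠ a ∧ r ≠ b ∧ r ≠ c := by
    intro r hr
    simpa using hR hr
  have hends : ∀ r ∈ R, G.Adj a r ∨ G.Adj c r := by
    intro r hr
    obtain ⟨hrS, nra, nrb, nrc⟩ := hRS r hr
    by_contra! hn
    have hbr : G.Adj b r := by
      obtain ⟨s, hs, hrs⟩ := hRatt r hr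
      simp only [Finset.mem_insert, Finset.mem_singleton] at hs
      rcases hs with rfl | rfl | rfl
      · exact absurd hrs.symm hn.1
      · exact hrs.symm
      · exact absurd hrs.symm hn.2
    exact hn.2 (hclaw3 b hb a ha c hc r hrS hab.symm hbc hbr nac nra.symm nrc.symm hac hn.1)
  have hsub : ∀ A ⊆ R, Independent G A := fun A hA x hx y hy =>
    hRind x (hA hx) y (hA hy)
  have hRcard : R.card ≤ 3 := by
    by_contra! hR4
    set A := R.filter (G.Adj a)
    set B := R.filter fun r => ¬G.Adj a r
    have hAB : A.card + B.card = R.card := Finset.card_filter_add_card_filter_not _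
    have hA : A.card ≤ 2 := hclaw a ha A
      (fun r hr => (hRS r (Finset.mem_filter.1 hr).1).1)
      (fun r hr => (Finset.mem_filter.1 hr).2) (hsub _ (Finset.filter_subset _ _))
    have hB : B.card ≤ 2 := hclaw c hc B
      (fun r hr => (hRS r (Finset.mem_filter.1 hr).1).1)
      (fun r hr => (hends r (Finset.mem_filter.1 hr).1).resolve_left (Finset.mem_filter.1 hr).2)
      (hsub _ (Finset.filter_subset _ _))
    obtain ⟨r₁, h1, r₂, h2, n12⟩ := Finset.one_lt_card.1 (show 1 < A.card by omega)
    obtain ⟨r₃, h3, r₄, h4, n34⟩ := Finset.one_lt_card.1 (show 1 < B.card by omega)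
    obtain ⟨h1R, h1a⟩ := Finset.mem_filter.1 h1
    obtain ⟨h2R, h2a⟩ := Finset.mem_filter.1 h2
    obtain ⟨h3R, h3a⟩ := Finset.mem_filter.1 h3
    obtain ⟨h4R, h4a⟩ := Finset.mem_filter.1 h4
    refine hI r₁ (hRS _ h1R).1 a ha r₂ (hRS _ h2R).1
      ⟨h1a.symm, h2a, hRind _ h1R _ h2R, n12⟩ r₃ (hRS _ h3R).1 c hc r₄ (hRS _ h4R).1
      ⟨((hends _ h3R).resolve_left h3a).symm, (hends _ h4R).resolve_left h4a,
        hRind _ h3R _ h4R, n34⟩ ?_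
    have n13 : r₁ ≠ r₃ := fun e => h3a (e ▸ h1a)
    have n14 : r₁ ≠ r₄ := fun e => h4a (e ▸ h1a)
    have n23 : r₂ ≠ r₃ := fun e => h3a (e ▸ h2a)
    have n24 : r₂ ≠ r₄ := fun e => h4a (e ▸ h2a)
    simp [n13.symm, n14.symm, n23.symm, n24.symm, nac.symm, (hRS _ h3R).2.1, (hRS _ h4R).2.1,
      (hRS _ h1R).2.2.2.symm, (hRS _ h2R).2.2.2.symm]
  have hbound : ∀ I ⊆ S, a ∉ I → b ∉ I → c ∉ I → Independent G I → I.card ≤ R.card := by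
    intro I hIS haI hbI hcI hind
    refine hRmax I (fun v hv => ?_) hind
    simp only [Finset.mem_sdiff, Finset.mem_insert, Finset.mem_singleton, not_or]
    exact ⟨hIS hv, fun e => haI (e ▸ hv), fun e => hbI (e ▸ hv), fun e => hcI (e ▸ hv)⟩
  by_cases hB1 : ∃ x ∈ R, ¬G.Adj x b
  · obtain ⟨x, hxR, hxb⟩ := hB1
    obtain ⟨hxS, nxa, nxb, nxc⟩ := hRS x hxR
    rcases hends x hxR with hax | hcx
    · exact certified_of_neighbor_of_end hS hI ha hb hc h
        (fun I h1 h2 h3 h4 h5 => (hbound I h1 h2 h3 h4 h5).trans hRcard) hxS nxb nxc hax.symm hxb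
    · exact certified_of_neighbor_of_end hS hI hc hb ha
        ⟨hbc.symm, hab.symm, fun e => hac e.symm, nac.symm⟩
        (fun I h1 h2 h3 h4 h5 => (hbound I h1 h4 h3 h2 h5).trans hRcard) hxS nxb nxa hcx.symm hxb
  push Not at hB1
  have hR2 : R.card ≤ 2 := hclaw b hb R (fun r hr => (hRS r hr).1)
    (fun r hr => (hB1 r hr).symm) hRind
  by_cases hR1 : R.card ≤ 1
  · have hstar := certified_star (G := G) (b := b) (L := {a, c}) (by simp)
      (by simp [hab.symm, hbc]) (by simp [hac, G.adj_comm c a])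
    rw [Finset.insert_comm] at hstar
    refine hRcert _ hstar ?_
    have h3 : (({a, b, c} : Finset V).card : ℝ) ≤ 3 := by exact_mod_cast Finset.card_le_three
    have h1 : (R.card : ℝ) ≤ 1 := by exact_mod_cast hR1
    rw [Finset.card_pair nac]
    norm_num
    linarith
  obtain ⟨x, hxR, y, hyR, nxy⟩ := Finset.one_lt_card.1 (not_le.1 hR1)
  obtain ⟨hxS, nxa, nxb, nxc⟩ := hRS x hxR
  obtain ⟨hyS, nya, nyb, nyc⟩ := hRS y hyR
  have hxy := hRind x hxR y hyR
  have hxb := hB1 x hxR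
  have hyb := hB1 y hyR
  have hdiamond : ∀ z ∈ S, G.Adj z a → G.Adj z b → G.Adj z c → Certified G S S.card := by
    intro z hz hza hzb hzc
    have hPS : ({z, a, b, c} : Finset V) ⊆ S := by
      simp [Finset.insert_subset_iff, ha, hb, hc, hz]
    refine certified_of_independent_card_le (k := 2) (w := 6) hS hPS (Finset.insert_nonempty _ _)
      (hI.not_inducedPath_sdiff hPS (by simp) (by simp) (by simp) h) ?_ Finset.card_le_four
      (certified_diamond hza hab hbc hac hzb hzc nac) (by norm_num)
    intro I hIS hind
    refine (hbound I (hIS.trans Finset.sdiff_subset) ?_ ?_ ?_ hind).trans hR2 <;>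
    · intro hm
      simpa using hIS hm
  have hbutterfly : ∀ x ∈ S, ∀ y ∈ S, G.Adj x b → G.Adj y b → x ≠ y → ¬G.Adj x y →
      x ≠ c → y ≠ a → G.Adj x a → G.Adj y c → ¬G.Adj x c → ¬G.Adj y a →
      Certified G S S.card := by
    intro x hxS y hyS hxb hyb nxy hxy nxc nya hxa hyc hxc hya
    have hPS : ({x, y, a, b, c} : Finset V) ⊆ S := by
      simp [Finset.insert_subset_iff, ha, hb, hc, hxS, hyS]
    refine certified_of_independent_card_le (k := 2) (w := 7) hS hPS (Finset.insert_nonempty _ _)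
      (hI.not_inducedPath_sdiff hPS (by simp) (by simp) (by simp) h) ?_ Finset.card_le_five
      (certified_butterfly hab hbc hac hxb hyb hxa hyc hxy hxc hya nac nxy nxc nya)
      (by norm_num)
    intro I hIS hind
    refine (hbound I (hIS.trans Finset.sdiff_subset) ?_ ?_ ?_ hind).trans hR2 <;>
    · intro hm
      simpa using hIS hm
  by_cases hxa : G.Adj x a
  · by_cases hxc : G.Adj x c
    · exact hdiamond x hxS hxa hxb hxc
    have hyc : G.Adj y c := hclaw3 b hb x hxS y hyS c hc hxb.symm hyb.symm hbc nxy nxc nyc hxy hxc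
    by_cases hya : G.Adj y a
    · exact hdiamond y hyS hya hyb hyc
    · exact hbutterfly x hxS y hyS hxb hyb nxy hxy nxc nya hxa hyc hxc hya
  · have hya : G.Adj y a :=
      hclaw3 b hb x hxS y hyS a ha hxb.symm hyb.symm hab.symm nxy nxa nya hxy hxa
    by_cases hyc : G.Adj y c
    · exact hdiamond y hyS hya hyb hyc
    have hxc : G.Adj x c := by
      by_contra hxc
      exact hyc (hclaw3 b hb x hxS y hyS c hc hxb.symm hyb.symm hbc nxy nxc nyc hxy hxc)
    exact hbutterfly y hyS x hxS hyb hxb nxy.symm (fun e => hxy e.symm) nyc nxa hya hxc hyc hxa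

lemma certified_of_not_adj (S : Finset V) : ConnectedOn G S →
    (∃ x ∈ S, ∃ y ∈ S, x ≠ y ∧ ¬G.Adj x y) → Certified G S S.card := by
  induction S using Finset.strongInduction with
  | H S ih =>
  rintro hS ⟨x, hx, y, hy, hxy, hn⟩
  by_cases hI : PathsIntersect G S
  · obtain ⟨a, ha, b, hb, c, hc, h⟩ := hS.exists_inducedPath hx hy hxy hn
    by_cases hclaw : ∀ b ∈ S, ∀ L ⊆ S, (∀ l ∈ L, G.Adj b l) → Independent G L → L.card ≤ 2
    · exact certified_of_claw_free hS hI hclaw ha hb hc h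
    · push Not at hclaw
      obtain ⟨b, hb, L, hLS, hbL, hL, hcard⟩ := hclaw
      exact certified_of_claw hS hI hb hLS hbL hL hcard
  · unfold PathsIntersect at hI
    push Not at hI
    obtain ⟨a, ha, b, hb, c, hc, h, a', ha', b', hb', c', hc', h', hd⟩ := hI
    obtain ⟨X, Y, hX, hY, hXY, hU, hcX, hcY⟩ := hS.exists_partition _ _ _ rfl
      (by simp [Finset.insert_subset_iff, ha, hb, hc])
      (by simp [Finset.insert_subset_iff, ha', hb', hc']) (Finset.insert_nonempty _ _) hd
      h.connectedOn h'.connectedOn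
    have hXS : X ⊂ S := Finset.ssubset_iff_subset_ne.2 ⟨hU ▸ Finset.subset_union_left, fun e =>
      Finset.disjoint_left.1 hXY (e ▸ ha') (hY (by simp))⟩
    have hYS : Y ⊂ S := Finset.ssubset_iff_subset_ne.2 ⟨hU ▸ Finset.subset_union_right, fun e =>
      Finset.disjoint_right.1 hXY (e ▸ ha) (hX (by simp))⟩
    have := (ih X hXS hcX ⟨a, hX (by simp), c, hX (by simp), h.2.2.2, h.2.2.1⟩).union
      (ih Y hYS hcY ⟨a', hY (by simp), c', hY (by simp), h'.2.2.2, h'.2.2.1⟩) hXY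
    rw [hU] at this
    refine this.mono (le_of_eq ?_)
    rw [← hU, Finset.card_union_of_disjoint hXY]
    push_cast
    rfl

omit [DecidableEq V] in
lemma connectedOn_univ (hconn : G.Connected) : ConnectedOn G Finset.univ := by
  intro C _ hne hC
  obtain ⟨v, hv⟩ := hne
  obtain ⟨w, hw⟩ : ∃ w, w ∉ C := by
    by_contra! h
    exact hC (Finset.eq_univ_iff_forall.2 h)
  obtain ⟨p⟩ := hconn.preconnected v w
  obtain ⟨d, -, hd, hd'⟩ := p.exists_boundary_dart (C : Set V) hv hw
  exact ⟨d.fst, hd, d.snd, Finset.mem_univ _, hd', d.adj⟩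

end NegEnergy

/-- For a connected graph `G` of order `n ≥ 3` that is not isomorphic to the complete
graph, the negative `4`-energy of `G` is at least `n`. -/
theorem negEnergy_four_ge {n : ℕ} (hn : 3 ≤ n) (G : SimpleGraph (Fin n))
    (hconn : G.Connected) (hK : ¬Nonempty (G ≃g (⊤ : SimpleGraph (Fin n)))) :
    (n : ℝ) ≤ gNegEnergy G 4 := by
  have hne : ∃ x ∈ Finset.univ, ∃ y ∈ Finset.univ, x ≠ y ∧ ¬G.Adj x y := by
    by_contra! h
    have : G = ⊤ := by
      ext x y
      exact ⟨fun hxy => hxy.ne, fun hxy => h x (Finset.mem_univ _) y (Finset.mem_univ _) hxy⟩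
    exact hK (this ▸ ⟨SimpleGraph.Iso.refl⟩)
  have := (NegEnergy.certified_of_not_adj Finset.univ
    (NegEnergy.connectedOn_univ hconn) hne).le_gNegEnergy
  simpa using this
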